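/- arXiv:1906.09411 — 2 statements merged into one kernel-verified Lean document; each statement's English description precedes it below -/
import Mathlib

section
/- Let μ be a Borel probability measure on ℝ^d, and let S : ℝ^d → ℝ^{d×d} be measurable, bounded, with S(x) symmetric positive semidefinite for every x. For ψ ∈ C_c^∞(ℝ^d) set |ψ|²_{H¹(μ)} = ∫ ∇ψ·S∇ψ dμ. Let φ ∈ L¹(μ) be such that its H^{−1}(μ) seminorm is finite, i.e. sup over ψ ∈ C_c^∞(ℝ^d) of (2∫ φψ dμ − |ψ|²_{H¹(μ)}) < ∞. Then ∫ φ dμ = 0. -/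
open Real MeasureTheory Filter Topology
open scoped BigOperators ENNReal

/-- Partial derivative in direction `i`. -/
noncomputable def pd {d : ℕ} (i : Fin d) (φ : EuclideanSpace ℝ (Fin d) → ℝ)
    (x : EuclideanSpace ℝ (Fin d)) : ℝ :=
  fderiv ℝ φ x (EuclideanSpace.single i 1)

/-- The overdamped Langevin generator `Lφ = −∇V·∇φ + Δφ`. -/
noncomputable def Lov {d : ℕ} (V φ : EuclideanSpace ℝ (Fin d) → ℝ)
    (x : EuclideanSpace ℝ (Fin d)) : ℝ :=
  (-∑ i, pd i V x * pd i φ x) + ∑ i, pd i (pd i φ) x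

/-- If `φ ∈ L¹(μ)` has finite `H^{−1}(μ)` seminorm, i.e. the quantity
`2∫ φψ dμ − ∫ ∇ψ·S∇ψ dμ` is bounded above over `ψ ∈ C_c^∞`, then `∫ φ dμ = 0`. -/
theorem stmt12 (d : ℕ) (μ : Measure (EuclideanSpace ℝ (Fin d))) [IsProbabilityMeasure μ]
    (S : EuclideanSpace ℝ (Fin d) → Matrix (Fin d) (Fin d) ℝ)
    (hSmeas : ∀ i j, Measurable fun x => S x i j)
    (hSbd : ∃ K : ℝ, ∀ x i j, |S x i j| ≤ K)
    (hSpsd : ∀ x, (S x).PosSemidef)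
    (φ : EuclideanSpace ℝ (Fin d) → ℝ) (hφ : Integrable φ μ)
    (hfin : ∃ B : ℝ, ∀ ψ : EuclideanSpace ℝ (Fin d) → ℝ,
      ContDiff ℝ (⊤ : ℕ∞) ψ → HasCompactSupport ψ →
      2 * ∫ x, φ x * ψ x ∂μ - ∫ x, ∑ i, ∑ j, S x i j * pd i ψ x * pd j ψ x ∂μ ≤ B) :
    ∫ x, φ x ∂μ = 0 := by
  obtain ⟨K, hK⟩ := hSbd
  obtain ⟨B, hB⟩ := hfin
  let χ : ContDiffBump (0 : EuclideanSpace ℝ (Fin d)) := ⟨1, 2, by norm_num, by norm_num⟩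
  have hχ : ContDiff ℝ (⊤ : ℕ∞) χ := χ.contDiff
  have hχc : HasCompactSupport χ := χ.hasCompactSupport
  obtain ⟨C, hC⟩ := (hχc.fderiv (𝕜 := ℝ)).exists_bound_of_continuous
    (hχ.continuous_fderiv (by simp))
  let a : ℕ → ℝ := fun n => 1 / ((n : ℝ) + 1)
  have ha : ∀ n, a n ≠ 0 := fun n => by
    have : (0 : ℝ) < (n : ℝ) + 1 := by positivity
    exact (one_div_pos.2 this).ne'
  have ha0 : Tendsto a atTop (𝓝 0) := tendsto_one_div_add_atTop_nhds_zero_nat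
  have hlim : Tendsto (fun n => ∫ x, φ x * χ (a n • x) ∂μ) atTop (𝓝 (∫ x, φ x ∂μ)) := by
    refine tendsto_integral_of_dominated_convergence (fun x => ‖φ x‖) ?_ hφ.norm ?_ ?_
    · intro n
      refine hφ.aestronglyMeasurable.mul ?_
      exact (hχ.continuous.comp (continuous_const_smul (a n))).aestronglyMeasurable
    · intro n
      refine Eventually.of_forall fun x => ?_
      rw [norm_mul]
      refine mul_le_of_le_one_right (norm_nonneg _) ?_
      rw [Real.norm_eq_abs, abs_of_nonneg χ.nonneg]
      exact χ.le_one
    · refine Eventually.of_forall fun x => ?_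
      have h1 : Tendsto (fun n => χ (a n • x)) atTop (𝓝 (χ ((0 : ℝ) • x))) :=
        (hχ.continuous.tendsto _).comp (ha0.smul_const x)
      have h2 : χ ((0 : ℝ) • x) = 1 := by
        rw [zero_smul]
        exact χ.one_of_mem_closedBall (by simp [χ])
      rw [h2] at h1
      simpa using h1.const_mul (φ x)
  have hpd : ∀ (t : ℝ) (n : ℕ) (i : Fin d) x,
      |pd i (fun x => t * χ (a n • x)) x| ≤ |t| * |a n| * C := by
    intro t n i x
    have hd : HasFDerivAt (fun x => t * χ (a n • x))
        (t • ((fderiv ℝ χ (a n • x)).comp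
          (a n • ContinuousLinearMap.id ℝ (EuclideanSpace ℝ (Fin d))))) x := by
      refine HasFDerivAt.const_mul ?_ t
      exact ((hχ.differentiable (by simp)) (a n • x)).hasFDerivAt.comp x
        ((hasFDerivAt_id x).const_smul (a n))
    unfold pd
    rw [hd.fderiv]
    have h3 : |fderiv ℝ χ (a n • x) (EuclideanSpace.single i 1)| ≤ C := by
      have := (fderiv ℝ χ (a n • x)).le_of_opNorm_le (hC _) (EuclideanSpace.single i 1)
      simpa using this
    simp only [ContinuousLinearMap.smul_apply, ContinuousLinearMap.comp_apply,
      ContinuousLinearMap.id_apply, map_smul, smul_eq_mul, abs_mul]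
    rw [mul_assoc]
    gcongr
  have hC0 : 0 ≤ C := (norm_nonneg _).trans (hC 0)
  have key : ∀ (t : ℝ) (n : ℕ), 2 * (t * ∫ x, φ x * χ (a n • x) ∂μ) -
      (d : ℝ) * (d * (|K| * (|t| * |a n| * C) * (|t| * |a n| * C))) ≤ B := by
    intro t n
    have h := hB (fun x => t * χ (a n • x))
      (contDiff_const.mul (hχ.comp (contDiff_const_smul (a n))))
      ((hχc.comp_smul (ha n)).mul_left (f := fun _ => t))
    have h4 : ∫ x, φ x * (t * χ (a n • x)) ∂μ = t * ∫ x, φ x * χ (a n • x) ∂μ := by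
      rw [← integral_const_mul]
      congr 1
      ext x
      ring
    rw [h4] at h
    have h5 := norm_integral_le_of_norm_le_const (μ := μ)
      (f := fun x => ∑ i, ∑ j, S x i j * pd i (fun x => t * χ (a n • x)) x *
        pd j (fun x => t * χ (a n • x)) x)
      (C := (d : ℝ) * (d * (|K| * (|t| * |a n| * C) * (|t| * |a n| * C))))
      (Eventually.of_forall fun x => by
        have h6 : ∀ i j, ‖S x i j * pd i (fun x => t * χ (a n • x)) x *
            pd j (fun x => t * χ (a n • x)) x‖ ≤
            |K| * (|t| * |a n| * C) * (|t| * |a n| * C) := by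
          intro i j
          rw [Real.norm_eq_abs, abs_mul, abs_mul]
          have := (hK x i j).trans (le_abs_self K)
          have := hpd t n i x
          have := hpd t n j x
          gcongr
        refine (norm_sum_le_of_le _ fun i _ => norm_sum_le_of_le _ fun j _ => h6 i j).trans ?_
        simp)
    rw [probReal_univ, mul_one, Real.norm_eq_abs] at h5
    have := le_abs_self (∫ x, ∑ i, ∑ j, S x i j * pd i (fun x => t * χ (a n • x)) x *
        pd j (fun x => t * χ (a n • x)) x ∂μ)
    linarith
  have key2 : ∀ t : ℝ, 2 * (t * ∫ x, φ x ∂μ) ≤ B := by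
    intro t
    have h7 : Tendsto (fun n => |t| * |a n| * C) atTop (𝓝 0) := by
      simpa using (ha0.abs.const_mul |t|).mul_const C
    have h8 := ((hlim.const_mul t).const_mul 2).sub
      ((((h7.const_mul |K|).mul h7).const_mul (d : ℝ)).const_mul (d : ℝ))
    simp only [mul_zero, sub_zero] at h8
    exact le_of_tendsto' h8 (key t)
  by_contra hne
  have h9 := key2 ((B + 1) / (2 * ∫ x, φ x ∂μ))
  have h10 : 2 * ((B + 1) / (2 * ∫ x, φ x ∂μ) * ∫ x, φ x ∂μ) = B + 1 := by
    field_simp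
  linarith
end

section
/- Let κ : ℝ^d → [1, ∞) be continuous with compact level sets, and let Ψ : ℝ^d → [0, ∞) be lower semicontinuous such that Ψ/κ has compact level sets. Let N ≥ 0 and let (ν_n) be a sequence of Borel probability measures on ℝ^d with ∫ Ψ dν_n ≤ N for all n. Then there exist a subsequence (ν_{n_k}) and a Borel probability measure ν with ∫ κ dν < ∞ such that ∫ f dν_{n_k} → ∫ f dν for every continuous function f : ℝ^d → ℝ with |f| ≤ κ pointwise. -/
open MeasureTheory Filter Topology
open scoped ENNReal

lemma aux_trunc {E : Type*} [TopologicalSpace E] [MeasurableSpace E] [BorelSpace E]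
    (κ : E → ℝ) (hκ1 : ∀ x, 1 ≤ κ x) (hκc : Continuous κ) (μ : Measure E)
    [IsProbabilityMeasure μ] (R c : ℝ) (hR : 0 ≤ R) (hc : 0 ≤ c)
    (h : ∫⁻ x, ENNReal.ofReal (κ x - R) ∂μ ≤ ENNReal.ofReal c) :
    (∫⁻ x, ENNReal.ofReal (κ x) ∂μ) < ⊤ ∧
    ∀ f : E → ℝ, Continuous f → (∀ x, |f x| ≤ κ x) →
      |∫ x, f x ∂μ - ∫ x, max (min (f x) R) (-R) ∂μ| ≤ c := by
  have hfin : (∫⁻ x, ENNReal.ofReal (κ x) ∂μ) < ⊤ := by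
    calc (∫⁻ x, ENNReal.ofReal (κ x) ∂μ)
        ≤ ∫⁻ x, (ENNReal.ofReal (κ x - R) + ENNReal.ofReal R) ∂μ := by
          apply lintegral_mono
          intro x
          have := ENNReal.ofReal_add_le (p := κ x - R) (q := R)
          simpa using this
      _ = (∫⁻ x, ENNReal.ofReal (κ x - R) ∂μ) + ENNReal.ofReal R := by
          rw [lintegral_add_right _ measurable_const]; simp
      _ < ⊤ := ENNReal.add_lt_top.2 ⟨h.trans_lt ENNReal.ofReal_lt_top, ENNReal.ofReal_lt_top⟩
  have hκi : Integrable κ μ := by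
    refine ⟨hκc.measurable.aestronglyMeasurable, ?_⟩
    rw [hasFiniteIntegral_iff_ofReal (Eventually.of_forall fun x => by
      have := hκ1 x; simp; linarith)]
    exact hfin
  refine ⟨hfin, fun f hf hfκ => ?_⟩
  have hfi : Integrable f μ := hκi.mono' hf.measurable.aestronglyMeasurable
    (Eventually.of_forall hfκ)
  have hgc : Continuous fun x => max (min (f x) R) (-R) := by fun_prop
  have hgi : Integrable (fun x => max (min (f x) R) (-R)) μ := by
    refine (integrable_const R).mono' hgc.measurable.aestronglyMeasurable
      (Eventually.of_forall fun x => ?_)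
    rw [Real.norm_eq_abs, abs_le]
    exact ⟨le_max_right _ _, max_le (min_le_right _ _) (by linarith)⟩
  rw [← integral_sub hfi hgi]
  have h1 := ENNReal.toReal_mono ENNReal.ofReal_ne_top
    ((lintegral_mono (μ := μ) (f := fun x => ENNReal.ofReal
      |f x - max (min (f x) R) (-R)|) (fun x => by
        beta_reduce
        by_cases hx : κ x ≤ R
        · have := abs_le.1 ((hfκ x).trans hx)
          rw [min_eq_left this.2, max_eq_left this.1]; simp
        · apply ENNReal.ofReal_le_ofReal
          push Not at hx
          have := abs_le.1 (hfκ x)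
          rw [abs_le]
          rcases le_total (f x) R with h1 | h1 <;> rcases le_total (-R) (f x) with h2 | h2 <;>
          simp only [min_eq_left h1, min_eq_right h1, max_eq_left h2, max_eq_right h2,
            max_eq_left (show -R ≤ R by linarith)] <;> constructor <;> linarith)).trans h)
  rw [ENNReal.toReal_ofReal hc] at h1
  refine (abs_integral_le_integral_abs).trans ?_
  rw [integral_eq_lintegral_of_nonneg_ae (Eventually.of_forall fun x => abs_nonneg _)
    (show Continuous fun x => |f x - max (min (f x) R) (-R)| by
      fun_prop).measurable.aestronglyMeasurable]
  exact h1

/-- Sequential precompactness of `{ν : ν(Ψ) ≤ N}` in the weighted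
topology associated with a weight `κ ≪ Ψ`: any sequence of probability measures with
`∫ Ψ dν_n ≤ N` admits a subsequence converging, against every continuous `f` with
`|f| ≤ κ`, to a probability measure `ν` with `∫ κ dν < ∞`. -/
theorem stmt18 (d : ℕ) (κ : EuclideanSpace ℝ (Fin d) → ℝ)
    (hκ1 : ∀ x, 1 ≤ κ x) (hκc : Continuous κ)
    (hκlev : ∀ M : ℝ, IsCompact {x | κ x ≤ M})
    (Ψ : EuclideanSpace ℝ (Fin d) → ℝ) (hΨlsc : LowerSemicontinuous Ψ) (hΨ0 : ∀ x, 0 ≤ Ψ x)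
    (hratio : ∀ M : ℝ, IsCompact {x | Ψ x / κ x ≤ M})
    (N : ℝ) (hN : 0 ≤ N)
    (ν : ℕ → Measure (EuclideanSpace ℝ (Fin d))) (hνprob : ∀ n, IsProbabilityMeasure (ν n))
    (hbound : ∀ n, (∫⁻ x, ENNReal.ofReal (Ψ x) ∂(ν n)) ≤ ENNReal.ofReal N) :
    ∃ s : ℕ → ℕ, StrictMono s ∧
      ∃ νlim : Measure (EuclideanSpace ℝ (Fin d)), IsProbabilityMeasure νlim ∧
        (∫⁻ x, ENNReal.ofReal (κ x) ∂νlim) < ⊤ ∧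
        ∀ f : EuclideanSpace ℝ (Fin d) → ℝ, Continuous f → (∀ x, |f x| ≤ κ x) →
          Tendsto (fun k => ∫ x, f x ∂(ν (s k))) atTop (nhds (∫ x, f x ∂νlim)) := by
  have key : ∀ ε : ℝ, 0 < ε → ∃ R : ℝ, 0 ≤ R ∧ ∀ n,
      ∫⁻ x, ENNReal.ofReal (κ x - R) ∂(ν n) ≤ ENNReal.ofReal ε := by
    intro ε hε
    obtain ⟨R, hR⟩ := (hratio ((N + 1) / ε)).bddAbove_image hκc.continuousOn
    refine ⟨max R 0, le_max_right _ _, fun n => ?_⟩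
    have hpt : ∀ x, ENNReal.ofReal (κ x - max R 0) ≤
        ENNReal.ofReal (ε / (N + 1)) * ENNReal.ofReal (Ψ x) := by
      intro x
      rw [← ENNReal.ofReal_mul (by positivity)]
      apply ENNReal.ofReal_le_ofReal
      have hp : 0 ≤ ε / (N + 1) * Ψ x := mul_nonneg (by positivity) (hΨ0 x)
      by_cases hx : Ψ x / κ x ≤ (N + 1) / ε
      · have h1 : κ x ≤ R := hR ⟨x, hx, rfl⟩
        have := le_max_left R 0
        linarith
      · push Not at hx
        have hk : 0 < κ x := lt_of_lt_of_le one_pos (hκ1 x)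
        rw [lt_div_iff₀ hk, div_mul_eq_mul_div, div_lt_iff₀ hε] at hx
        have h2 : κ x ≤ ε / (N + 1) * Ψ x := by
          rw [div_mul_eq_mul_div, le_div_iff₀ (by linarith)]
          nlinarith
        have := le_max_right R 0
        linarith
    calc ∫⁻ x, ENNReal.ofReal (κ x - max R 0) ∂(ν n)
        ≤ ∫⁻ x, ENNReal.ofReal (ε / (N + 1)) * ENNReal.ofReal (Ψ x) ∂(ν n) :=
          lintegral_mono hpt
      _ = ENNReal.ofReal (ε / (N + 1)) * ∫⁻ x, ENNReal.ofReal (Ψ x) ∂(ν n) :=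
          lintegral_const_mul' _ _ ENNReal.ofReal_ne_top
      _ ≤ ENNReal.ofReal (ε / (N + 1)) * ENNReal.ofReal N := by gcongr; exact hbound n
      _ ≤ ENNReal.ofReal ε := by
          rw [← ENNReal.ofReal_mul (by positivity)]
          apply ENNReal.ofReal_le_ofReal
          rw [div_mul_eq_mul_div, div_le_iff₀ (by linarith)]
          nlinarith
  let P : ℕ → ProbabilityMeasure (EuclideanSpace ℝ (Fin d)) := fun n => ⟨ν n, hνprob n⟩
  have htight : IsTightMeasureSet
      {((μ : ProbabilityMeasure (EuclideanSpace ℝ (Fin d))) :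
        Measure (EuclideanSpace ℝ (Fin d))) | μ ∈ Set.range P} := by
    rw [isTightMeasureSet_iff_exists_isCompact_measure_compl_le]
    intro ε hε
    obtain ⟨δ, hδ, hδε⟩ : ∃ δ : ℝ, 0 < δ ∧ ENNReal.ofReal δ ≤ ε := by
      rcases eq_or_ne ε ⊤ with rfl | h
      · exact ⟨1, one_pos, le_top⟩
      · exact ⟨ε.toReal, ENNReal.toReal_pos hε.ne' h, by rw [ENNReal.ofReal_toReal h]⟩
    obtain ⟨R, hR0, hR⟩ := key δ hδ
    refine ⟨_, hκlev (R + 1), ?_⟩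
    rintro _ ⟨_, ⟨n, rfl⟩, rfl⟩
    refine le_trans ?_ ((hR n).trans hδε)
    change ν n _ ≤ _
    have hms : MeasurableSet {x | κ x ≤ R + 1}ᶜ := (hκlev (R + 1)).isClosed.measurableSet.compl
    rw [← lintegral_indicator_one hms]
    apply lintegral_mono
    intro x
    by_cases hx : κ x ≤ R + 1
    · simp [hx]
    · have : x ∈ {x | κ x ≤ R + 1}ᶜ := hx
      simp only [Set.indicator_of_mem this, Pi.one_apply]
      rw [← ENNReal.ofReal_one]
      apply ENNReal.ofReal_le_ofReal
      linarith
  obtain ⟨Q, -, s, hs, hlim⟩ := (isCompact_closure_of_isTightMeasureSet htight).tendsto_subseq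
    (x := P) (fun n => subset_closure ⟨n, rfl⟩)
  have keyQ : ∀ ε R : ℝ, (∀ n, ∫⁻ x, ENNReal.ofReal (κ x - R) ∂(ν n) ≤ ENNReal.ofReal ε) →
      ∫⁻ x, ENNReal.ofReal (κ x - R) ∂(Q : Measure _) ≤ ENNReal.ofReal ε := by
    intro ε R hR
    have h1 := lintegral_le_liminf_lintegral_of_forall_isOpen_measure_le_liminf_measure
      (μ := (Q : Measure _)) (μs := fun k => ν (s k)) (f := fun x => max (κ x - R) 0)
      (by fun_prop) (fun x => le_max_right _ _)
      (fun G hG => ProbabilityMeasure.le_liminf_measure_open_of_tendsto hlim hG)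
    have h2 : ∀ x, ENNReal.ofReal (max (κ x - R) 0) = ENNReal.ofReal (κ x - R) := by
      intro x
      rw [ENNReal.ofReal_max]; simp
    simp only [h2] at h1
    refine h1.trans (liminf_le_of_le (by isBoundedDefault) ?_)
    intro b hb
    obtain ⟨k, hk⟩ := hb.exists
    exact hk.trans (hR _)
  refine ⟨s, hs, Q, inferInstance, ?_, ?_⟩
  · obtain ⟨R, hR0, hR⟩ := key 1 one_pos
    exact (aux_trunc κ hκ1 hκc Q R 1 hR0 zero_le_one (keyQ _ _ hR)).1
  · intro f hf hfκ
    rw [Metric.tendsto_atTop]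
    intro ε hε
    obtain ⟨R, hR0, hR⟩ := key (ε / 4) (by positivity)
    have hQ := (aux_trunc κ hκ1 hκc Q R (ε / 4) hR0 (by positivity) (keyQ _ _ hR)).2 f hf hfκ
    let g : BoundedContinuousFunction (EuclideanSpace ℝ (Fin d)) ℝ :=
      BoundedContinuousFunction.ofNormedAddCommGroup (fun x => max (min (f x) R) (-R))
        (by fun_prop) R (fun x => by
          rw [Real.norm_eq_abs, abs_le]
          exact ⟨le_max_right _ _, max_le (min_le_right _ _) (by linarith)⟩)
    have hg := ProbabilityMeasure.tendsto_iff_forall_integral_tendsto.1 hlim g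
    obtain ⟨k0, hk0⟩ := Metric.tendsto_atTop.1 hg (ε / 4) (by positivity)
    refine ⟨k0, fun k hk => ?_⟩
    have h1 : |∫ x, max (min (f x) R) (-R) ∂(ν (s k)) -
      ∫ x, max (min (f x) R) (-R) ∂(Q : Measure _)| < ε / 4 := hk0 k hk
    have := hνprob (s k)
    have h2 := (aux_trunc κ hκ1 hκc (ν (s k)) R (ε / 4) hR0 (by positivity) (hR _)).2 f hf hfκ
    rw [Real.dist_eq]
    rw [abs_le] at hQ h2
    rw [abs_lt] at h1 ⊢
    constructor <;> linarith
end
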